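/- Let n ≥ 2 and let A = (a_{ij}) be a nonzero symmetric real n×n matrix with trace zero. Define g: ℝ^n → ℝ by g(x) = Σ_{i,j=1}^n a_{ij} x_i x_j, and let f = C·g where C > 0 is the constant such that ∫_{S^{n-1}} f² dσ = 1. Let d ∈ ℝ^n be the vector of eigenvalues of A, and let W = f(X). Then d_TV(W, Z) ≤ √6 · (‖d‖₄/‖d‖₂)², where ‖d‖_p = (Σ_i |d_i|^p)^{1/p}. -/

import Mathlib

open MeasureTheory ProbabilityTheory Real Finset

noncomputable section

/-- total variation distance between two (Borel) measures on ℝ -/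
def dTV (μ ν : MeasureTheory.Measure ℝ) : ℝ :=
  ⨆ s : {s : Set ℝ // MeasurableSet s}, |(μ s.1).toReal - (ν s.1).toReal|

/-- uniform probability measure on the unit sphere of a Euclidean space -/
def sphereUniform (ι : Type*) [Fintype ι] :
    MeasureTheory.Measure (Metric.sphere (0 : EuclideanSpace ℝ ι) 1) :=
  ((volume : MeasureTheory.Measure (EuclideanSpace ℝ ι)).toSphere Set.univ)⁻¹ •
    (volume : MeasureTheory.Measure (EuclideanSpace ℝ ι)).toSphere

section Stein

open Filter Topology
open scoped ENNReal

lemma integrable_exp_neg_sq_div_two : Integrable (fun t : ℝ => rexp (-t ^ 2 / 2)) := by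
  have h := integrable_exp_neg_mul_sq (b := (1 : ℝ) / 2) (by norm_num)
  refine h.congr (Eventually.of_forall fun t => ?_)
  simp only
  congr 1
  ring

lemma integrable_mul_exp_neg_sq_div_two : Integrable (fun t : ℝ => t * rexp (-t ^ 2 / 2)) := by
  have h := integrable_mul_exp_neg_mul_sq (b := (1 : ℝ) / 2) (by norm_num)
  refine h.congr (Eventually.of_forall fun t => ?_)
  simp only
  congr 2
  ring

lemma integral_Ioi_mul_exp_neg_sq_div_two (w : ℝ) :
    ∫ t in Set.Ioi w, t * rexp (-t ^ 2 / 2) = rexp (-w ^ 2 / 2) := by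
  have hderiv : ∀ x ∈ Set.Ici w,
      HasDerivAt (fun t : ℝ => -rexp (-t ^ 2 / 2)) (x * rexp (-x ^ 2 / 2)) x := by
    intro x _
    have h : HasDerivAt (fun t : ℝ => -t ^ 2 / 2) (-x) x := by
      refine ((hasDerivAt_pow 2 x).fun_neg.div_const 2).congr_deriv ?_
      push_cast
      ring
    exact h.exp.fun_neg.congr_deriv (by ring)
  have hlim : Tendsto (fun t : ℝ => -rexp (-t ^ 2 / 2)) atTop (𝓝 0) := by
    rw [← neg_zero]
    refine Tendsto.neg (Real.tendsto_exp_atBot.comp ?_)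
    have h : Tendsto (fun t : ℝ => t ^ 2 / 2) atTop atTop :=
      (tendsto_pow_atTop two_ne_zero).atTop_div_const (by norm_num)
    refine (tendsto_neg_atTop_atBot.comp h).congr fun t => ?_
    simp only [Function.comp_apply]
    ring
  rw [integral_Ioi_of_hasDerivAt_of_tendsto' hderiv
    integrable_mul_exp_neg_sq_div_two.integrableOn hlim]
  ring

/-- Mills' inequality for the Gaussian tail. -/
lemma mul_integral_Ioi_exp_le (w : ℝ) :
    w * ∫ t in Set.Ioi w, rexp (-t ^ 2 / 2) ≤ rexp (-w ^ 2 / 2) := by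
  rw [← integral_Ioi_mul_exp_neg_sq_div_two w, ← integral_const_mul]
  refine setIntegral_mono_on (integrable_exp_neg_sq_div_two.const_mul w).integrableOn
    integrable_mul_exp_neg_sq_div_two.integrableOn measurableSet_Ioi fun t ht => ?_
  exact mul_le_mul_of_nonneg_right (le_of_lt ht) (exp_pos _).le

lemma neg_mul_integral_Iic_exp_le (w : ℝ) :
    -w * ∫ t in Set.Iic w, rexp (-t ^ 2 / 2) ≤ rexp (-w ^ 2 / 2) := by
  have h := mul_integral_Ioi_exp_le (-w)
  rw [← integral_comp_neg_Iic] at h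
  simpa using h

lemma integrable_mul_exp_of_abs_le {k : ℝ → ℝ} (hk : Continuous k) {M : ℝ}
    (hM : ∀ t, |k t| ≤ M) : Integrable (fun t : ℝ => k t * rexp (-t ^ 2 / 2)) :=
  integrable_exp_neg_sq_div_two.bdd_mul hk.aestronglyMeasurable
    (Eventually.of_forall hM)

lemma integral_sub_mean_mul_exp {h : ℝ → ℝ} (hc : Continuous h) (h0 : ∀ t, 0 ≤ h t)
    (h1 : ∀ t, h t ≤ 1) :
    ∫ t, (h t - ∫ s, h s ∂(gaussianReal 0 1)) * rexp (-t ^ 2 / 2) = 0 := by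
  set c := ∫ s, h s ∂(gaussianReal 0 1) with hcdef
  have hi : Integrable h (gaussianReal 0 1) :=
    Integrable.of_bound hc.aestronglyMeasurable 1
      (Eventually.of_forall fun t => by rw [Real.norm_eq_abs, abs_of_nonneg (h0 t)]; exact h1 t)
  have hz : ∫ t, (h t - c) ∂(gaussianReal 0 1) = 0 := by
    rw [integral_sub hi (integrable_const _)]
    simp [hcdef]
  rw [integral_gaussianReal_eq_integral_smul one_ne_zero] at hz
  have hpi : (√(2 * π))⁻¹ ≠ 0 := by positivity
  have : ∫ t, (√(2 * π))⁻¹ * ((h t - c) * rexp (-t ^ 2 / 2)) = 0 := by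
    rw [← hz]
    refine integral_congr_ae (Eventually.of_forall fun t => ?_)
    simp only [gaussianPDFReal, smul_eq_mul, NNReal.coe_one, mul_one, sub_zero]
    ring
  rw [integral_const_mul] at this
  exact (mul_eq_zero.mp this).resolve_left hpi

lemma mul_integral_Iic_sub_mean_le {h : ℝ → ℝ} (hc : Continuous h) (h0 : ∀ t, 0 ≤ h t)
    (h1 : ∀ t, h t ≤ 1) (w : ℝ) :
    w * ∫ t in Set.Iic w, (h t - ∫ s, h s ∂(gaussianReal 0 1)) * rexp (-t ^ 2 / 2)
      ≤ (∫ s, h s ∂(gaussianReal 0 1)) * rexp (-w ^ 2 / 2) := by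
  have htot := integral_sub_mean_mul_exp hc h0 h1
  have hcn : 0 ≤ ∫ s, h s ∂(gaussianReal 0 1) := integral_nonneg h0
  set c := ∫ s, h s ∂(gaussianReal 0 1)
  have hint : Integrable (fun t : ℝ => (h t - c) * rexp (-t ^ 2 / 2)) := by
    refine integrable_mul_exp_of_abs_le (hc.sub continuous_const) (M := 1 + c) fun t => ?_
    rw [abs_le]
    constructor <;> linarith [h0 t, h1 t]
  have hlow : ∀ S : Set ℝ, MeasurableSet S →
      -(c * ∫ t in S, rexp (-t ^ 2 / 2)) ≤ ∫ t in S, (h t - c) * rexp (-t ^ 2 / 2) := by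
    intro S hS
    rw [← integral_const_mul, ← integral_neg]
    refine setIntegral_mono_on (integrable_exp_neg_sq_div_two.const_mul c).neg.integrableOn
      hint.integrableOn hS fun t _ => ?_
    nlinarith [mul_nonneg (h0 t) (exp_pos (-t ^ 2 / 2)).le]
  rcases le_total 0 w with hw | hw
  · have hsplit := integral_add_compl (measurableSet_Iic (a := w)) hint
    rw [htot, Set.compl_Iic] at hsplit
    have h2 := hlow _ (measurableSet_Ioi (a := w))
    have h3 := mul_le_mul_of_nonneg_left (mul_integral_Ioi_exp_le w) hcn
    nlinarith [mul_le_mul_of_nonneg_left h2 hw]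
  · have h2 := hlow _ (measurableSet_Iic (a := w))
    have h3 := mul_le_mul_of_nonneg_left (neg_mul_integral_Iic_exp_le w) hcn
    nlinarith [mul_le_mul_of_nonneg_left h2 (neg_nonneg.mpr hw)]

/-- Existence of a solution of Stein's equation with derivative bounded by one. -/
lemma exists_stein_solution {h : ℝ → ℝ} (hc : Continuous h) (h0 : ∀ t, 0 ≤ h t)
    (h1 : ∀ t, h t ≤ 1) :
    ∃ φ φ' : ℝ → ℝ, (∀ w, HasDerivAt φ (φ' w) w) ∧ Continuous φ' ∧ (∀ w, |φ' w| ≤ 1) ∧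
      ∀ w, φ' w - w * φ w = h w - ∫ s, h s ∂(gaussianReal 0 1) := by
  have hup := mul_integral_Iic_sub_mean_le hc h0 h1
  have hlo := mul_integral_Iic_sub_mean_le (h := fun t => 1 - h t) (continuous_const.sub hc)
    (fun t => sub_nonneg.mpr (h1 t)) (fun t => by linarith [h0 t])
  have hi : Integrable h (gaussianReal 0 1) :=
    Integrable.of_bound hc.aestronglyMeasurable 1
      (Eventually.of_forall fun t => by rw [Real.norm_eq_abs, abs_of_nonneg (h0 t)]; exact h1 t)
  have hmean : ∫ s, (1 - h s) ∂(gaussianReal 0 1) = 1 - ∫ s, h s ∂(gaussianReal 0 1) := by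
    rw [integral_sub (integrable_const _) hi]
    simp
  rw [hmean] at hlo
  have hcn : 0 ≤ ∫ s, h s ∂(gaussianReal 0 1) := integral_nonneg h0
  set c := ∫ s, h s ∂(gaussianReal 0 1)
  have hkc : Continuous (fun t : ℝ => (h t - c) * rexp (-t ^ 2 / 2)) := by fun_prop
  have hint : Integrable (fun t : ℝ => (h t - c) * rexp (-t ^ 2 / 2)) := by
    refine integrable_mul_exp_of_abs_le (hc.sub continuous_const) (M := 1 + c) fun t => ?_
    rw [abs_le]
    constructor <;> linarith [h0 t, h1 t]
  set K : ℝ → ℝ := fun w => ∫ t in Set.Iic w, (h t - c) * rexp (-t ^ 2 / 2) with hK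
  have hKd : ∀ w, HasDerivAt K ((h w - c) * rexp (-w ^ 2 / 2)) w := by
    intro w
    have heq : K = fun w => (∫ t in (0 : ℝ)..w, (h t - c) * rexp (-t ^ 2 / 2)) + K 0 := by
      funext v
      rw [← intervalIntegral.integral_Iic_sub_Iic hint.integrableOn hint.integrableOn]
      simp [hK]
    rw [heq]
    exact (intervalIntegral.integral_hasDerivAt_right hint.intervalIntegrable
      hkc.aestronglyMeasurable.stronglyMeasurableAtFilter hkc.continuousAt).add_const _
  have hed : ∀ w : ℝ, HasDerivAt (fun w : ℝ => rexp (w ^ 2 / 2)) (w * rexp (w ^ 2 / 2)) w := by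
    intro w
    have h' : HasDerivAt (fun t : ℝ => t ^ 2 / 2) w w := by
      refine ((hasDerivAt_pow 2 w).div_const 2).congr_deriv ?_
      push_cast
      ring
    exact h'.exp.congr_deriv (by ring)
  have hee : ∀ w : ℝ, rexp (w ^ 2 / 2) * rexp (-w ^ 2 / 2) = 1 := by
    intro w
    rw [← exp_add, neg_div, add_neg_cancel, exp_zero]
  have hKcont : Continuous K := continuous_iff_continuousAt.mpr fun w => (hKd w).continuousAt
  refine ⟨fun w => rexp (w ^ 2 / 2) * K w,
    fun w => w * (rexp (w ^ 2 / 2) * K w) + (h w - c), fun w => ?_, by fun_prop, fun w => ?_,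
    fun w => by ring⟩
  · refine ((hed w).fun_mul (hKd w)).congr_deriv ?_
    linear_combination (h w - c) * hee w
  · have hKneg : ∫ t in Set.Iic w, (1 - h t - (1 - c)) * rexp (-t ^ 2 / 2) = -K w := by
      rw [hK, ← integral_neg]
      refine integral_congr_ae (Eventually.of_forall fun t => ?_)
      simp only
      ring
    have hu := mul_le_mul_of_nonneg_left (hup w) (exp_pos (w ^ 2 / 2)).le
    have hl := mul_le_mul_of_nonneg_left (hlo w) (exp_pos (w ^ 2 / 2)).le
    rw [hKneg] at hl
    have hu' : w * (rexp (w ^ 2 / 2) * K w) ≤ c := by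
      linear_combination hu + c * hee w
    have hl' : -(w * (rexp (w ^ 2 / 2) * K w)) ≤ 1 - c := by
      linear_combination hl + (1 - c) * hee w
    rw [abs_le]
    constructor <;> linarith [h0 w, h1 w]

lemma abs_measureReal_sub_le_of_isClosed {μ ν : Measure ℝ} [IsProbabilityMeasure μ]
    [IsProbabilityMeasure ν] {B : ℝ}
    (hB : ∀ h : ℝ → ℝ, Continuous h → (∀ t, 0 ≤ h t) → (∀ t, h t ≤ 1) →
      |∫ t, h t ∂μ - ∫ t, h t ∂ν| ≤ B) {F : Set ℝ} (hF : IsClosed F) :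
    |μ.real F - ν.real F| ≤ B := by
  have hpos : ∀ n : ℕ, (0 : ℝ) < 1 / ((n : ℝ) + 1) := fun n => Nat.one_div_pos_of_nat
  have hlim := tendsto_one_div_add_atTop_nhds_zero_nat (𝕜 := ℝ)
  have h1 := tendsto_integral_thickenedIndicator_of_isClosed μ hF hpos hlim
  have h2 := tendsto_integral_thickenedIndicator_of_isClosed ν hF hpos hlim
  refine le_of_tendsto (h1.sub h2).abs (Eventually.of_forall fun n => ?_)
  refine hB _ ?_ (fun t => NNReal.coe_nonneg _) fun t => ?_
  · exact NNReal.continuous_coe.comp (thickenedIndicator (hpos n) F).continuous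
  · exact_mod_cast thickenedIndicator_le_one (hpos n) F t

/-- Continuous test functions with values in `[0, 1]` control the total variation distance. -/
lemma dTV_le_of_continuous {μ ν : Measure ℝ} [IsProbabilityMeasure μ]
    [IsProbabilityMeasure ν] {B : ℝ}
    (hB : ∀ h : ℝ → ℝ, Continuous h → (∀ t, 0 ≤ h t) → (∀ t, h t ≤ 1) →
      |∫ t, h t ∂μ - ∫ t, h t ∂ν| ≤ B) : dTV μ ν ≤ B := by
  have hone : ∀ s : Set ℝ, MeasurableSet s → μ.real s - ν.real s ≤ B := by
    intro s hs
    refine le_of_forall_pos_le_add fun ε hε => ?_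
    obtain ⟨F, hFs, hF, hlt⟩ := hs.exists_isClosed_lt_add (measure_ne_top μ s)
      (ε := ENNReal.ofReal ε) (by simpa using hε)
    have h1 : μ.real s ≤ μ.real F + ε := by
      have := ENNReal.toReal_mono (by finiteness) hlt.le
      rwa [ENNReal.toReal_add (by finiteness) (by finiteness), ENNReal.toReal_ofReal hε.le] at this
    have h2 : ν.real F ≤ ν.real s := measureReal_mono hFs
    have h3 := (abs_le.mp (abs_measureReal_sub_le_of_isClosed hB hF)).2
    linarith
  have : Nonempty {s : Set ℝ // MeasurableSet s} := ⟨⟨∅, MeasurableSet.empty⟩⟩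
  refine ciSup_le fun s => ?_
  have h1 := hone s.1 s.2
  have h2 := hone s.1ᶜ s.2.compl
  rw [probReal_compl_eq_one_sub s.2, probReal_compl_eq_one_sub s.2] at h2
  change |μ.real s.1 - ν.real s.1| ≤ B
  rw [abs_le]
  constructor <;> linarith

end Stein

section Sphere

open Filter Topology
open scoped Pointwise

variable {ι : Type*} [Fintype ι]

/-- The action of a linear isometry on the unit sphere. -/
def sphereMap (e : EuclideanSpace ℝ ι ≃ₗᵢ[ℝ] EuclideanSpace ℝ ι)
    (x : Metric.sphere (0 : EuclideanSpace ℝ ι) 1) : Metric.sphere (0 : EuclideanSpace ℝ ι) 1 :=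
  ⟨e x, by simp⟩

lemma continuous_sphereMap (e : EuclideanSpace ℝ ι ≃ₗᵢ[ℝ] EuclideanSpace ℝ ι) :
    Continuous (sphereMap e) :=
  (e.continuous.comp continuous_subtype_val).subtype_mk _

lemma map_sphereMap_toSphere (e : EuclideanSpace ℝ ι ≃ₗᵢ[ℝ] EuclideanSpace ℝ ι) :
    Measure.map (sphereMap e) (volume : Measure (EuclideanSpace ℝ ι)).toSphere =
      (volume : Measure (EuclideanSpace ℝ ι)).toSphere := by
  have hm := (continuous_sphereMap e).measurable
  ext s hs
  rw [Measure.map_apply hm hs, Measure.toSphere_apply' _ hs, Measure.toSphere_apply' _ (hm hs)]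
  congr 1
  have hset : Set.Ioo (0 : ℝ) 1 • (Subtype.val '' (sphereMap e ⁻¹' s)) =
      e ⁻¹' (Set.Ioo (0 : ℝ) 1 • (Subtype.val '' s)) := by
    ext x
    simp only [Set.mem_smul, Set.mem_preimage, Set.mem_image]
    constructor
    · rintro ⟨r, hr, _, ⟨y, hy, rfl⟩, rfl⟩
      exact ⟨r, hr, e y, ⟨sphereMap e y, hy, rfl⟩, by simp⟩
    · rintro ⟨r, hr, _, ⟨y, hy, rfl⟩, hx⟩
      refine ⟨r, hr, e.symm y, ⟨sphereMap e.symm y, ?_, rfl⟩, ?_⟩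
      · have : sphereMap e (sphereMap e.symm y) = y := Subtype.ext (by simp [sphereMap])
        simpa [this] using hy
      · apply e.injective
        simpa using hx
  rw [hset]
  exact e.measurePreserving.measure_preimage_equiv (f := e.toMeasurableEquiv) _

lemma map_sphereMap_sphereUniform (e : EuclideanSpace ℝ ι ≃ₗᵢ[ℝ] EuclideanSpace ℝ ι) :
    Measure.map (sphereMap e) (sphereUniform ι) = sphereUniform ι := by
  rw [sphereUniform, Measure.map_smul, map_sphereMap_toSphere]

lemma integral_sphereUniform_comp (e : EuclideanSpace ℝ ι ≃ₗᵢ[ℝ] EuclideanSpace ℝ ι)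
    {F : EuclideanSpace ℝ ι → ℝ} (hF : Continuous F) :
    ∫ x : Metric.sphere (0 : EuclideanSpace ℝ ι) 1, F (e x) ∂(sphereUniform ι) =
      ∫ x : Metric.sphere (0 : EuclideanSpace ℝ ι) 1, F x ∂(sphereUniform ι) := by
  conv_rhs => rw [← map_sphereMap_sphereUniform e]
  rw [integral_map (f := fun x : Metric.sphere (0 : EuclideanSpace ℝ ι) 1 => F x)
    (continuous_sphereMap e).aemeasurable
    (hF.comp continuous_subtype_val).aestronglyMeasurable]
  rfl

instance isProbabilityMeasure_sphereUniform [Nonempty ι] :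
    IsProbabilityMeasure (sphereUniform ι) := by
  constructor
  rw [sphereUniform, Measure.smul_apply, smul_eq_mul]
  refine ENNReal.inv_mul_cancel ?_ (measure_ne_top _ _)
  rw [Ne, Measure.measure_univ_eq_zero]
  exact Measure.toSphere_ne_zero _

lemma integrable_sphereUniform [Nonempty ι] {F : EuclideanSpace ℝ ι → ℝ} (hF : Continuous F) :
    Integrable (fun x : Metric.sphere (0 : EuclideanSpace ℝ ι) 1 => F x) (sphereUniform ι) := by
  have hFc := hF.comp (continuous_subtype_val (p := (· ∈ Metric.sphere (0 : EuclideanSpace ℝ ι) 1)))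
  have : CompactSpace (Metric.sphere (0 : EuclideanSpace ℝ ι) 1) :=
    isCompact_iff_compactSpace.mp (isCompact_sphere 0 1)
  exact hFc.integrable_of_hasCompactSupport (HasCompactSupport.of_compactSpace _)

variable [DecidableEq ι]

/-- Rotation by the angle `t` in the coordinate plane spanned by `i` and `j`, as a linear map. -/
def planeRotationLinear (i j : ι) (t : ℝ) : EuclideanSpace ℝ ι →ₗ[ℝ] EuclideanSpace ℝ ι where
  toFun x := WithLp.toLp 2 fun k =>
    if k = i then cos t * x i - sin t * x j
    else if k = j then sin t * x i + cos t * x j else x k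
  map_add' x y := by
    ext k
    simp only [PiLp.add_apply]
    split_ifs <;> ring
  map_smul' c x := by
    ext k
    simp only [PiLp.smul_apply, smul_eq_mul, RingHom.id_apply]
    split_ifs <;> ring

omit [Fintype ι] in
lemma planeRotationLinear_apply (i j : ι) (t : ℝ) (x : EuclideanSpace ℝ ι) (k : ι) :
    planeRotationLinear i j t x k = if k = i then cos t * x i - sin t * x j
      else if k = j then sin t * x i + cos t * x j else x k := rfl

lemma norm_planeRotationLinear {i j : ι} (hij : i ≠ j) (t : ℝ) (x : EuclideanSpace ℝ ι) :
    ‖planeRotationLinear i j t x‖ = ‖x‖ := by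
  rw [EuclideanSpace.norm_eq, EuclideanSpace.norm_eq]
  congr 1
  have hji : j ∈ univ.erase i := by simp [hij.symm]
  rw [← add_sum_erase _ _ (mem_univ i), ← add_sum_erase _ _ hji,
    ← add_sum_erase _ _ (mem_univ i), ← add_sum_erase _ _ hji, ← add_assoc, ← add_assoc]
  congr 1
  · simp only [planeRotationLinear_apply, Real.norm_eq_abs, sq_abs, if_true, hij.symm, if_false]
    linear_combination (x i ^ 2 + x j ^ 2) * sin_sq_add_cos_sq t
  · refine sum_congr rfl fun k hk => ?_
    simp only [mem_erase] at hk
    simp [planeRotationLinear_apply, hk.1, hk.2.1]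

/-- Rotation by the angle `t` in the coordinate plane spanned by `i` and `j`. -/
def planeRotation {i j : ι} (hij : i ≠ j) (t : ℝ) :
    EuclideanSpace ℝ ι ≃ₗᵢ[ℝ] EuclideanSpace ℝ ι :=
  LinearIsometry.toLinearIsometryEquiv
    ⟨planeRotationLinear i j t, norm_planeRotationLinear hij t⟩ rfl

lemma planeRotation_apply {i j : ι} (hij : i ≠ j) (t : ℝ) (x : EuclideanSpace ℝ ι) (k : ι) :
    planeRotation hij t x k = if k = i then cos t * x i - sin t * x j
      else if k = j then sin t * x i + cos t * x j else x k := rfl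

lemma hasDerivAt_planeRotation {i j : ι} (hij : i ≠ j) (x : EuclideanSpace ℝ ι) (k : ι) (t : ℝ) :
    HasDerivAt (fun s => planeRotation hij s x k)
      (if k = i then -planeRotation hij t x j
        else if k = j then planeRotation hij t x i else 0) t := by
  simp only [planeRotation_apply, if_true, hij.symm, if_false]
  split_ifs with h1 h2
  · exact (((hasDerivAt_cos t).mul_const _).sub ((hasDerivAt_sin t).mul_const _)).congr_deriv
      (by ring)
  · exact (((hasDerivAt_sin t).mul_const _).add ((hasDerivAt_cos t).mul_const _)).congr_deriv
      (by ring)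
  · exact hasDerivAt_const _ _

/-- Derivatives along the rotation flow of a coordinate plane have mean zero on the sphere. -/
lemma integral_deriv_planeRotation_eq_zero [Nonempty ι] {i j : ι} (hij : i ≠ j)
    {F L : EuclideanSpace ℝ ι → ℝ} (hF : Continuous F) (hL : Continuous L)
    (hd : ∀ x t, HasDerivAt (fun s => F (planeRotation hij s x)) (L (planeRotation hij t x)) t) :
    ∫ x : Metric.sphere (0 : EuclideanSpace ℝ ι) 1, L x ∂(sphereUniform ι) = 0 := by
  obtain ⟨M, hM⟩ := (isCompact_sphere (0 : EuclideanSpace ℝ ι) 1).exists_bound_of_continuousOn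
    hL.continuousOn
  have hconst : ∀ s, ∫ x : Metric.sphere (0 : EuclideanSpace ℝ ι) 1,
      F (planeRotation hij s x) ∂(sphereUniform ι) =
      ∫ x : Metric.sphere (0 : EuclideanSpace ℝ ι) 1, F x ∂(sphereUniform ι) :=
    fun s => integral_sphereUniform_comp _ hF
  have h := (hasDerivAt_integral_of_dominated_loc_of_deriv_le
    (μ := sphereUniform ι) (x₀ := (0 : ℝ)) (s := Set.univ) (bound := fun _ => M)
    (F := fun s x => F (planeRotation hij s x)) (F' := fun s x => L (planeRotation hij s x))
    univ_mem
    (Eventually.of_forall fun s => (integrable_sphereUniform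
      (hF.comp (planeRotation hij s).continuous)).aestronglyMeasurable)
    (integrable_sphereUniform (hF.comp (planeRotation hij 0).continuous))
    (integrable_sphereUniform (hL.comp (planeRotation hij 0).continuous)).aestronglyMeasurable
    (Eventually.of_forall fun x s _ => hM _ (by simp))
    (integrable_const _) (Eventually.of_forall fun x s _ => hd x s)).2
  simp only [hconst] at h
  rw [← integral_sphereUniform_comp (planeRotation hij 0) hL]
  exact h.unique (hasDerivAt_const _ _)

end Sphere

section QuadraticForm

open Filter Topology

variable {ι : Type*} [Fintype ι]

/-- The diagonal quadratic form with coefficients `d`. -/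
def diagForm (d : ι → ℝ) (x : EuclideanSpace ℝ ι) : ℝ := ∑ k, d k * x k ^ 2

@[fun_prop]
lemma continuous_diagForm (d : ι → ℝ) : Continuous (diagForm d) := by
  unfold diagForm
  fun_prop

lemma sum_sq_eq_one_of_mem_sphere (x : Metric.sphere (0 : EuclideanSpace ℝ ι) 1) :
    ∑ k, (x : EuclideanSpace ℝ ι) k ^ 2 = 1 := by
  rw [← EuclideanSpace.real_norm_sq_eq, norm_eq_of_mem_sphere, one_pow]

lemma diagForm_sq_le (d : ι → ℝ) (x : Metric.sphere (0 : EuclideanSpace ℝ ι) 1) :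
    diagForm d x ^ 2 ≤ diagForm (fun k => d k ^ 2) x := by
  calc diagForm d x ^ 2 = (∑ k, d k * x.1 k * x.1 k) ^ 2 := by
        simp only [diagForm, sq, mul_assoc]
    _ ≤ (∑ k, (d k * x.1 k) ^ 2) * ∑ k, x.1 k ^ 2 := sum_mul_sq_le_sq_mul_sq _ _ _
    _ = diagForm (fun k => d k ^ 2) x := by
        simp only [sum_sq_eq_one_of_mem_sphere x, mul_one, diagForm, mul_pow]

variable [DecidableEq ι]

lemma hasDerivAt_diagForm_planeRotation (d : ι → ℝ) {i j : ι} (hij : i ≠ j)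
    (x : EuclideanSpace ℝ ι) (t : ℝ) :
    HasDerivAt (fun s => diagForm d (planeRotation hij s x))
      (2 * (d j - d i) * planeRotation hij t x i * planeRotation hij t x j) t := by
  have h := HasDerivAt.fun_sum (u := univ) fun k _ =>
    ((hasDerivAt_planeRotation hij x k t).fun_pow 2).const_mul (d k)
  refine h.congr_deriv ?_
  have hji : j ∈ univ.erase i := by simp [hij.symm]
  rw [← add_sum_erase _ _ (mem_univ i), ← add_sum_erase _ _ hji, sum_eq_zero]
  · simp only [if_true, hij.symm, if_false]
    push_cast
    ring
  · intro k hk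
    simp only [mem_erase] at hk
    simp [hk.1, hk.2.1]

variable [Nonempty ι]

lemma integral_planeRotation_diagForm (d : ι → ℝ) {ψ ψ' : ℝ → ℝ}
    (hψ : ∀ s, HasDerivAt ψ (ψ' s) s) (hψ' : Continuous ψ') (i j : ι) :
    ∫ x : Metric.sphere (0 : EuclideanSpace ℝ ι) 1,
      (d j - d i) * (ψ' (diagForm d x) * (2 * (d j - d i) * x.1 i * x.1 j) * (x.1 i * x.1 j)
        + ψ (diagForm d x) * (x.1 i ^ 2 - x.1 j ^ 2)) ∂(sphereUniform ι) = 0 := by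
  rcases eq_or_ne i j with rfl | hij
  · simp
  have hψc : Continuous ψ := continuous_iff_continuousAt.mpr fun s => (hψ s).continuousAt
  rw [integral_const_mul]
  rw [integral_deriv_planeRotation_eq_zero hij
    (F := fun x => ψ (diagForm d x) * (x i * x j))
    (L := fun x => ψ' (diagForm d x) * (2 * (d j - d i) * x i * x j) * (x i * x j)
        + ψ (diagForm d x) * (x i ^ 2 - x j ^ 2)) (by fun_prop) (by fun_prop), mul_zero]
  intro x t
  have h1 := (hψ _).comp t (hasDerivAt_diagForm_planeRotation d hij x t)
  have h2 := (hasDerivAt_planeRotation hij x i t).fun_mul (hasDerivAt_planeRotation hij x j t)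
  refine (h1.fun_mul h2).congr_deriv ?_
  simp only [if_true, hij.symm, if_false, Function.comp_apply]
  ring

/-- Integration by parts on the sphere for a traceless diagonal quadratic form, which is an
eigenfunction of the spherical Laplacian. -/
lemma integral_deriv_comp_diagForm (d : ι → ℝ) (hd : ∑ i, d i = 0) {ψ ψ' : ℝ → ℝ}
    (hψ : ∀ s, HasDerivAt ψ (ψ' s) s) (hψ' : Continuous ψ') :
    ∫ x : Metric.sphere (0 : EuclideanSpace ℝ ι) 1,
      (2 * (ψ' (diagForm d x) * (diagForm (fun k => d k ^ 2) x - diagForm d x ^ 2))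
        - Fintype.card ι * (ψ (diagForm d x) * diagForm d x)) ∂(sphereUniform ι) = 0 := by
  have hψc : Continuous ψ := continuous_iff_continuousAt.mpr fun s => (hψ s).continuousAt
  have hsum : ∑ i, ∑ j, ∫ x : Metric.sphere (0 : EuclideanSpace ℝ ι) 1,
      (d j - d i) * (ψ' (diagForm d x) * (2 * (d j - d i) * x.1 i * x.1 j) * (x.1 i * x.1 j)
        + ψ (diagForm d x) * (x.1 i ^ 2 - x.1 j ^ 2)) ∂(sphereUniform ι) = 0 :=
    sum_eq_zero fun i _ => sum_eq_zero fun j _ => integral_planeRotation_diagForm d hψ hψ' i j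
  have hint : ∀ i j : ι, Integrable (fun x : Metric.sphere (0 : EuclideanSpace ℝ ι) 1 =>
      (d j - d i) * (ψ' (diagForm d x) * (2 * (d j - d i) * x.1 i * x.1 j) * (x.1 i * x.1 j)
        + ψ (diagForm d x) * (x.1 i ^ 2 - x.1 j ^ 2))) (sphereUniform ι) := fun i j =>
    integrable_sphereUniform (F := fun x =>
      (d j - d i) * (ψ' (diagForm d x) * (2 * (d j - d i) * x i * x j) * (x i * x j)
        + ψ (diagForm d x) * (x i ^ 2 - x j ^ 2))) (by fun_prop)
  simp_rw [← integral_finsetSum _ fun j _ => hint _ j] at hsum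
  rw [← integral_finsetSum _ fun i _ => integrable_finsetSum _ fun j _ => hint i j] at hsum
  have hhalf : ∀ x : Metric.sphere (0 : EuclideanSpace ℝ ι) 1,
      ∑ i, ∑ j, (d j - d i) * (ψ' (diagForm d x) * (2 * (d j - d i) * x.1 i * x.1 j)
        * (x.1 i * x.1 j) + ψ (diagForm d x) * (x.1 i ^ 2 - x.1 j ^ 2)) =
      2 * (2 * (ψ' (diagForm d x) * (diagForm (fun k => d k ^ 2) x - diagForm d x ^ 2))
        - Fintype.card ι * (ψ (diagForm d x) * diagForm d x)) := by
    intro x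
    have h1 := sum_sq_eq_one_of_mem_sphere x
    have hq : diagForm d x = ∑ k, d k * x.1 k ^ 2 := rfl
    have hU : diagForm (fun k => d k ^ 2) x = ∑ k, d k ^ 2 * x.1 k ^ 2 := rfl
    have hcard : ∑ i, d i * (Fintype.card ι * x.1 i ^ 2) = Fintype.card ι * diagForm d x := by
      rw [hq, mul_sum]
      exact sum_congr rfl fun i _ => by ring
    set a := ψ' (diagForm d x)
    set b := ψ (diagForm d x)
    have hterm : ∀ i j : ι, (d j - d i) * (a * (2 * (d j - d i) * x.1 i * x.1 j)
        * (x.1 i * x.1 j) + b * (x.1 i ^ 2 - x.1 j ^ 2)) =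
        2 * a * (x.1 i ^ 2 * (d j ^ 2 * x.1 j ^ 2)) + 2 * a * ((d i ^ 2 * x.1 i ^ 2) * x.1 j ^ 2)
        - 4 * a * ((d i * x.1 i ^ 2) * (d j * x.1 j ^ 2))
        + b * (x.1 i ^ 2 * d j) - b * (1 * (d j * x.1 j ^ 2)) - b * ((d i * x.1 i ^ 2) * 1)
        + b * (d i * x.1 j ^ 2) := by
      intro i j
      ring
    simp only [hterm, sum_add_distrib, sum_sub_distrib, ← mul_sum, ← sum_mul, h1, hd, ← hU, ← hq,
      sum_const, card_univ, nsmul_eq_mul, mul_one]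
    rw [hcard]
    ring
  simp_rw [hhalf] at hsum
  rw [integral_const_mul] at hsum
  simpa using hsum

lemma integral_sq_mul_sq_sphereUniform (i j : ι) :
    ∫ x : Metric.sphere (0 : EuclideanSpace ℝ ι) 1, x.1 i ^ 2 * x.1 j ^ 2 ∂(sphereUniform ι) =
      (if i = j then 3 else 1) / (Fintype.card ι * (Fintype.card ι + 2)) := by
  have hint : ∀ i j : ι, Integrable (fun x : Metric.sphere (0 : EuclideanSpace ℝ ι) 1 =>
      x.1 i ^ 2 * x.1 j ^ 2) (sphereUniform ι) := fun i j =>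
    integrable_sphereUniform (F := fun x => x i ^ 2 * x j ^ 2) (by fun_prop)
  set m : ι → ι → ℝ := fun i j =>
    ∫ x : Metric.sphere (0 : EuclideanSpace ℝ ι) 1, x.1 i ^ 2 * x.1 j ^ 2 ∂(sphereUniform ι)
    with hm
  have hrot : ∀ i j : ι, i ≠ j → m i i = 3 * m i j := by
    intro i j hij
    have h := integral_deriv_planeRotation_eq_zero hij
      (F := fun x => x i ^ 3 * x j)
      (L := fun x => x i ^ 2 * x i ^ 2 - 3 * (x i ^ 2 * x j ^ 2)) (by fun_prop) (by fun_prop) ?_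
    · rw [integral_sub (hint i i) ((hint i j).const_mul 3), integral_const_mul] at h
      linarith
    · intro x t
      have h2 := ((hasDerivAt_planeRotation hij x i t).fun_pow 3).fun_mul
        (hasDerivAt_planeRotation hij x j t)
      refine h2.congr_deriv ?_
      simp only [if_true, hij.symm, if_false]
      push_cast
      ring
  have hsymm : ∀ i j : ι, m i j = m j i := fun i j => by simp only [hm, mul_comm]
  have hval : ∀ k l : ι, m k l = m i i / 3 * (1 + if k = l then 2 else 0) := by
    have hdiag : ∀ k, m k k = m i i := by
      intro k
      rcases eq_or_ne k i with rfl | hk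
      · rfl
      · rw [hrot k i hk, hrot i k hk.symm, hsymm]
    intro k l
    split_ifs with hkl
    · subst hkl
      rw [hdiag]
      ring
    · rw [← hdiag k, hrot k l hkl]
      ring
  have htot : ∑ k, ∑ l, m k l = 1 := by
    simp_rw [hm, ← integral_finsetSum _ fun l _ => hint _ l]
    rw [← integral_finsetSum _ fun k _ => integrable_finsetSum _ fun l _ => hint k l]
    simp_rw [← sum_mul_sum, sum_sq_eq_one_of_mem_sphere]
    simp
  rw [sum_congr rfl fun k _ => sum_congr rfl fun l _ => hval k l] at htot
  simp only [← mul_sum, sum_add_distrib, sum_ite_eq, sum_const, card_univ, nsmul_eq_mul,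
    mul_one, mem_univ, if_true] at htot
  have hpos : (0 : ℝ) < Fintype.card ι := by exact_mod_cast Fintype.card_pos
  change m i j = _
  rw [hval, eq_div_iff (by positivity)]
  split_ifs
  · linear_combination 3 * htot
  · linear_combination htot

/-- Second moment of a diagonal quadratic form on the sphere. -/
lemma integral_diagForm_sq (a : ι → ℝ) :
    ∫ x : Metric.sphere (0 : EuclideanSpace ℝ ι) 1, diagForm a x ^ 2 ∂(sphereUniform ι) =
      ((∑ i, a i) ^ 2 + 2 * ∑ i, a i ^ 2) / (Fintype.card ι * (Fintype.card ι + 2)) := by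
  have hint : ∀ i j : ι, Integrable (fun x : Metric.sphere (0 : EuclideanSpace ℝ ι) 1 =>
      a i * a j * (x.1 i ^ 2 * x.1 j ^ 2)) (sphereUniform ι) := fun i j =>
    integrable_sphereUniform (F := fun x => a i * a j * (x i ^ 2 * x j ^ 2)) (by fun_prop)
  have hexp : ∀ x : Metric.sphere (0 : EuclideanSpace ℝ ι) 1,
      diagForm a x ^ 2 = ∑ i, ∑ j, a i * a j * (x.1 i ^ 2 * x.1 j ^ 2) := by
    intro x
    rw [diagForm, sq, sum_mul_sum]
    exact sum_congr rfl fun i _ => sum_congr rfl fun j _ => by ring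
  simp_rw [hexp]
  rw [integral_finsetSum _ fun i _ => integrable_finsetSum _ fun j _ => hint i j]
  simp_rw [integral_finsetSum _ fun j _ => hint _ j, integral_const_mul,
    integral_sq_mul_sq_sphereUniform]
  have hterm : ∀ i j : ι, a i * a j * ((if i = j then (3 : ℝ) else 1) /
      (Fintype.card ι * (Fintype.card ι + 2))) =
      (a i * a j + if i = j then 2 * (a i * a j) else 0) /
        (Fintype.card ι * (Fintype.card ι + 2)) := by
    intro i j
    split_ifs <;> ring
  simp_rw [hterm, ← sum_div, sum_add_distrib, sum_ite_eq, ← sum_mul_sum]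
  simp only [mem_univ, if_true, ← mul_sum, sq]

end QuadraticForm

section NormalApproximation

open Filter Topology

variable {ι : Type*} [Fintype ι] [DecidableEq ι] [Nonempty ι]

/-- If `C * diagForm d` has unit variance, its squared gradient, suitably normalized, has mean
square distance from one controlled by the fourth powers of `d`. -/
lemma integral_one_sub_gradient_sq_le (d : ι → ℝ) (hd : ∑ i, d i = 0)
    (hcard : 2 ≤ Fintype.card ι) {C : ℝ}
    (hC : ∫ x : Metric.sphere (0 : EuclideanSpace ℝ ι) 1, (C * diagForm d x) ^ 2
      ∂(sphereUniform ι) = 1) :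
    ∫ x : Metric.sphere (0 : EuclideanSpace ℝ ι) 1,
      (1 - 2 * C ^ 2 / Fintype.card ι * (diagForm (fun k => d k ^ 2) x - diagForm d x ^ 2)) ^ 2
      ∂(sphereUniform ι) ≤ 6 * (∑ i, d i ^ 4) / (∑ i, d i ^ 2) ^ 2 := by
  have hN : (2 : ℝ) ≤ Fintype.card ι := by exact_mod_cast hcard
  simp_rw [mul_pow] at hC
  rw [integral_const_mul, integral_diagForm_sq, hd] at hC
  have hibp := integral_deriv_comp_diagForm d hd (ψ := fun s => s) (ψ' := fun _ => 1)
    (fun s => hasDerivAt_id s) continuous_const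
  have hUi := integrable_sphereUniform (continuous_diagForm fun k => d k ^ 2)
  have hqi := integrable_sphereUniform (F := fun x => diagForm d x ^ 2) (by fun_prop)
  have hU2i := integrable_sphereUniform
    (F := fun x => diagForm (fun k => d k ^ 2) x ^ 2) (by fun_prop)
  have hTi : Integrable (fun x : Metric.sphere (0 : EuclideanSpace ℝ ι) 1 =>
      diagForm (fun k => d k ^ 2) x - diagForm d x ^ 2) (sphereUniform ι) := hUi.sub hqi
  simp only [one_mul, ← sq] at hibp
  rw [integral_sub (hTi.const_mul 2) (hqi.const_mul _), integral_const_mul, integral_const_mul,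
    integral_diagForm_sq, hd] at hibp
  have hcs : (∑ i, d i ^ 2) ^ 2 ≤ Fintype.card ι * ∑ i, d i ^ 4 := by
    have h := sq_sum_le_card_mul_sum_sq (s := univ) (f := fun i => d i ^ 2)
    simpa [← pow_mul] using h
  have hU2 := integral_diagForm_sq (fun k => d k ^ 2)
  simp only [← pow_mul, show 2 * 2 = 4 from rfl] at hU2
  have hp2 : 0 < ∑ i, d i ^ 2 := by
    refine lt_of_le_of_ne (sum_nonneg fun i _ => sq_nonneg _) fun h0 => ?_
    rw [← h0] at hC
    norm_num at hC
  set N : ℝ := (Fintype.card ι : ℝ)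
  set p := ∑ i, d i ^ 2
  set r := ∑ i, d i ^ 4
  have hNpos : 0 < N := by linarith
  have hC2 : C ^ 2 = N * (N + 2) / (2 * p) := by
    field_simp at hC ⊢
    linarith
  set B := 2 * C ^ 2 / N with hBdef
  have hB : B = (N + 2) / p := by
    rw [hBdef, hC2]
    field_simp
  have hmean : ∫ x : Metric.sphere (0 : EuclideanSpace ℝ ι) 1,
      (diagForm (fun k => d k ^ 2) x - diagForm d x ^ 2) ∂(sphereUniform ι) = p / (N + 2) := by
    field_simp at hibp ⊢
    linarith
  calc ∫ x : Metric.sphere (0 : EuclideanSpace ℝ ι) 1,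
        (1 - B * (diagForm (fun k => d k ^ 2) x - diagForm d x ^ 2)) ^ 2 ∂(sphereUniform ι)
      ≤ ∫ x : Metric.sphere (0 : EuclideanSpace ℝ ι) 1,
        (1 - 2 * B * (diagForm (fun k => d k ^ 2) x - diagForm d x ^ 2)
          + B ^ 2 * diagForm (fun k => d k ^ 2) x ^ 2) ∂(sphereUniform ι) := by
        refine integral_mono
          (integrable_sphereUniform (F := fun x =>
            (1 - B * (diagForm (fun k => d k ^ 2) x - diagForm d x ^ 2)) ^ 2) (by fun_prop))
          (integrable_sphereUniform (F := fun x =>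
            (1 - 2 * B * (diagForm (fun k => d k ^ 2) x - diagForm d x ^ 2)
              + B ^ 2 * diagForm (fun k => d k ^ 2) x ^ 2)) (by fun_prop)) fun x => ?_
        have h1 := diagForm_sq_le d x
        have h2 : (diagForm (fun k => d k ^ 2) x - diagForm d x ^ 2) ^ 2 ≤
            diagForm (fun k => d k ^ 2) x ^ 2 :=
          pow_le_pow_left₀ (by linarith) (by linarith [sq_nonneg (diagForm d x)]) 2
        have h3 := mul_le_mul_of_nonneg_left h2 (sq_nonneg B)
        simp only
        linarith
    _ = (N + 2) * (p ^ 2 + 2 * r) / (N * p ^ 2) - 1 := by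
        have h1T : Integrable (fun x : Metric.sphere (0 : EuclideanSpace ℝ ι) 1 =>
            1 - 2 * B * (diagForm (fun k => d k ^ 2) x - diagForm d x ^ 2)) (sphereUniform ι) :=
          (integrable_const _).sub (hTi.const_mul _)
        rw [integral_add h1T (hU2i.const_mul _),
          integral_sub (integrable_const _) (hTi.const_mul _), integral_const_mul,
          integral_const_mul, hmean, hU2, hB]
        simp only [integral_const, probReal_univ, smul_eq_mul, mul_one]
        field_simp
        ring
    _ ≤ 6 * r / p ^ 2 := by
        have hr : 0 ≤ r := sum_nonneg fun i _ => by positivity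
        rw [sub_le_iff_le_add, div_add_one (by positivity),
          div_le_div_iff₀ (by positivity) (by positivity)]
        have key : (N + 2) * (p ^ 2 + 2 * r) ≤ (6 * r + p ^ 2) * N := by nlinarith
        nlinarith [mul_le_mul_of_nonneg_right key (sq_nonneg p)]

/-- Normal approximation for a traceless diagonal quadratic form of a uniform point on the
sphere. -/
lemma dTV_map_diagForm_le (d : ι → ℝ) (hd : ∑ i, d i = 0)
    (hcard : 2 ≤ Fintype.card ι) {C : ℝ}
    (hC : ∫ x : Metric.sphere (0 : EuclideanSpace ℝ ι) 1, (C * diagForm d x) ^ 2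
      ∂(sphereUniform ι) = 1) :
    dTV (Measure.map (fun x : Metric.sphere (0 : EuclideanSpace ℝ ι) 1 => C * diagForm d x)
      (sphereUniform ι)) (gaussianReal 0 1) ≤ √(6 * (∑ i, d i ^ 4) / (∑ i, d i ^ 2) ^ 2) := by
  have hWc : Continuous fun x : Metric.sphere (0 : EuclideanSpace ℝ ι) 1 => C * diagForm d x :=
    continuous_const.mul ((continuous_diagForm d).comp continuous_subtype_val)
  have := Measure.isProbabilityMeasure_map (μ := sphereUniform ι) hWc.aemeasurable
  have hN : (Fintype.card ι : ℝ) ≠ 0 := by exact_mod_cast Fintype.card_ne_zero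
  refine dTV_le_of_continuous fun h hc h0 h1 => ?_
  obtain ⟨φ, φ', hφ, hφ'c, hφ'1, hstein⟩ := exists_stein_solution hc h0 h1
  have hφc : Continuous φ := continuous_iff_continuousAt.mpr fun s => (hφ s).continuousAt
  rw [integral_map hWc.aemeasurable hc.aestronglyMeasurable]
  set c := ∫ s, h s ∂(gaussianReal 0 1)
  have hibp := integral_deriv_comp_diagForm d hd (ψ := fun s => φ (C * s))
    (ψ' := fun s => φ' (C * s) * C)
    (fun s => (hφ (C * s)).comp s (((hasDerivAt_id s).const_mul C).congr_deriv (mul_one C)))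
    (by fun_prop)
  set Y : EuclideanSpace ℝ ι → ℝ := fun x => 1 - 2 * C ^ 2 / Fintype.card ι *
    (diagForm (fun k => d k ^ 2) x - diagForm d x ^ 2) with hY
  have hYc : Continuous Y := by fun_prop
  have heq : ∫ x : Metric.sphere (0 : EuclideanSpace ℝ ι) 1, h (C * diagForm d x)
      ∂(sphereUniform ι) - c =
      ∫ x : Metric.sphere (0 : EuclideanSpace ℝ ι) 1, φ' (C * diagForm d x) * Y x
        ∂(sphereUniform ι) := by
    have hL : ∫ x : Metric.sphere (0 : EuclideanSpace ℝ ι) 1, h (C * diagForm d x)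
        ∂(sphereUniform ι) - c =
        ∫ x : Metric.sphere (0 : EuclideanSpace ℝ ι) 1, (h (C * diagForm d x) - c)
          ∂(sphereUniform ι) := by
      rw [integral_sub (integrable_sphereUniform (F := fun x => h (C * diagForm d x))
        (by fun_prop)) (integrable_const _)]
      simp
    rw [hL, ← sub_eq_zero, ← integral_sub
      (integrable_sphereUniform (F := fun x => h (C * diagForm d x) - c) (by fun_prop))
      (integrable_sphereUniform (F := fun x => φ' (C * diagForm d x) * Y x) (by fun_prop)),
      ← mul_zero (C / Fintype.card ι), ← hibp, ← integral_const_mul]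
    refine integral_congr_ae (Eventually.of_forall fun x => ?_)
    simp only [← hstein, hY]
    field_simp
    ring
  rw [heq]
  refine Real.abs_le_sqrt (le_trans ?_ (integral_one_sub_gradient_sq_le d hd hcard hC))
  set m := ∫ x : Metric.sphere (0 : EuclideanSpace ℝ ι) 1, φ' (C * diagForm d x) * Y x
        ∂(sphereUniform ι)
  have hZi := integrable_sphereUniform (F := fun x => φ' (C * diagForm d x) * Y x) (by fun_prop)
  have hY2i := integrable_sphereUniform (F := fun x => Y x ^ 2) (by fun_prop)
  have hmono : ∫ x : Metric.sphere (0 : EuclideanSpace ℝ ι) 1,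
      (2 * m * (φ' (C * diagForm d x) * Y x) - m ^ 2) ∂(sphereUniform ι) ≤
      ∫ x : Metric.sphere (0 : EuclideanSpace ℝ ι) 1, Y x ^ 2 ∂(sphereUniform ι) := by
    refine integral_mono ((hZi.const_mul _).sub (integrable_const _)) hY2i fun x => ?_
    have h2 : φ' (C * diagForm d x) ^ 2 ≤ 1 := (sq_le_one_iff_abs_le_one _).mpr (hφ'1 _)
    simp only
    nlinarith [mul_le_mul_of_nonneg_right h2 (sq_nonneg (Y x)),
      sq_nonneg (φ' (C * diagForm d x) * Y x - m)]
  rw [integral_sub (hZi.const_mul _) (integrable_const _), integral_const_mul] at hmono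
  simp only [integral_const, probReal_univ, smul_eq_mul, one_mul] at hmono
  linarith [sq m]

omit [Nonempty ι] in
/-- In an orthonormal eigenbasis a quadratic form is diagonal. -/
lemma sum_mul_eigenvectorBasis_repr_symm {A : Matrix ι ι ℝ} (hA : A.IsHermitian)
    (y : EuclideanSpace ℝ ι) :
    ∑ i, ∑ j, A i j * hA.eigenvectorBasis.repr.symm y i * hA.eigenvectorBasis.repr.symm y j =
      diagForm hA.eigenvalues y := by
  set x := hA.eigenvectorBasis.repr.symm y with hx
  have hAx : A.toEuclideanLin x = ∑ k, (y k * hA.eigenvalues k) • hA.eigenvectorBasis k := by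
    rw [hx, ← OrthonormalBasis.sum_repr_symm, map_sum]
    refine sum_congr rfl fun k _ => ?_
    have hk : A.toEuclideanLin (hA.eigenvectorBasis k) =
        hA.eigenvalues k • hA.eigenvectorBasis k := by
      apply WithLp.ofLp_injective
      simpa using hA.mulVec_eigenvectorBasis k
    rw [map_smul, hk, smul_smul]
  have h1 : ∑ i, ∑ j, A i j * x i * x j = inner ℝ (A.toEuclideanLin x) x := by
    simp only [PiLp.inner_apply, Matrix.toLpLin_apply, Matrix.mulVec, dotProduct,
      RCLike.inner_apply, conj_trivial, mul_sum]
    exact sum_congr rfl fun i _ => sum_congr rfl fun j _ => by ring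
  rw [h1, hAx, sum_inner, diagForm]
  refine sum_congr rfl fun k _ => ?_
  rw [real_inner_smul_left, ← OrthonormalBasis.repr_apply_apply, hx,
    LinearIsometryEquiv.apply_symm_apply]
  ring

end NormalApproximation

theorem stmt0 (n : ℕ) (hn : 2 ≤ n) (A : Matrix (Fin n) (Fin n) ℝ)
    (hA : A.IsHermitian) (hA0 : A ≠ 0) (htr : A.trace = 0)
    (g : EuclideanSpace ℝ (Fin n) → ℝ)
    (hg : ∀ x, g x = ∑ i, ∑ j, A i j * x i * x j)
    (C : ℝ) (hC : 0 < C)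
    (hnorm : ∫ x : Metric.sphere (0 : EuclideanSpace ℝ (Fin n)) 1,
        (C * g x) ^ 2 ∂(sphereUniform (Fin n)) = 1)
    (f : EuclideanSpace ℝ (Fin n) → ℝ) (hf : ∀ x, f x = C * g x)
    (d : Fin n → ℝ) (hd : d = hA.eigenvalues) :
    dTV (MeasureTheory.Measure.map (fun x : Metric.sphere (0 : EuclideanSpace ℝ (Fin n)) 1 =>
            f x) (sphereUniform (Fin n)))
        (gaussianReal 0 1)
      ≤ Real.sqrt 6 *
        ((∑ i, |d i| ^ (4 : ℝ)) ^ ((1 : ℝ) / 4) / (∑ i, |d i| ^ (2 : ℝ)) ^ ((1 : ℝ) / 2)) ^ 2 := by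
  subst hd
  have : NeZero n := ⟨by omega⟩
  have htr' : ∑ i, hA.eigenvalues i = 0 := by
    rw [← htr, hA.trace_eq_sum_eigenvalues]
    rfl
  set e := hA.eigenvectorBasis.repr.symm
  have hge : ∀ y, g (e y) = diagForm hA.eigenvalues y := fun y => by
    rw [hg, sum_mul_eigenvectorBasis_repr_symm]
  have hgc : Continuous g := by
    rw [funext hg]
    fun_prop
  have hnorm' : ∫ x : Metric.sphere (0 : EuclideanSpace ℝ (Fin n)) 1,
      (C * diagForm hA.eigenvalues x) ^ 2 ∂(sphereUniform (Fin n)) = 1 := by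
    rw [← integral_sphereUniform_comp e (F := fun x => (C * g x) ^ 2) (by fun_prop)] at hnorm
    simpa only [hge] using hnorm
  have hmap : Measure.map (fun x : Metric.sphere (0 : EuclideanSpace ℝ (Fin n)) 1 => f x)
      (sphereUniform (Fin n)) =
      Measure.map (fun x : Metric.sphere (0 : EuclideanSpace ℝ (Fin n)) 1 =>
        C * diagForm hA.eigenvalues x) (sphereUniform (Fin n)) := by
    have hfm : Measurable fun x : Metric.sphere (0 : EuclideanSpace ℝ (Fin n)) 1 => f x := by
      simp only [hf]
      exact (continuous_const.mul (hgc.comp continuous_subtype_val)).measurable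
    conv_lhs => rw [← map_sphereMap_sphereUniform e]
    rw [Measure.map_map hfm (continuous_sphereMap e).measurable]
    congr 1
    funext x
    simp only [Function.comp_apply, hf, sphereMap, hge]
  rw [hmap]
  refine (dTV_map_diagForm_le _ htr' (by simpa using hn) hnorm').trans_eq ?_
  have h4 : ∑ i, |hA.eigenvalues i| ^ (4 : ℝ) = ∑ i, hA.eigenvalues i ^ 4 := by
    refine sum_congr rfl fun i _ => ?_
    rw [show (4 : ℝ) = (4 : ℕ) by norm_num, rpow_natCast]
    exact Even.pow_abs (by decide) _
  have h2 : ∑ i, |hA.eigenvalues i| ^ (2 : ℝ) = ∑ i, hA.eigenvalues i ^ 2 := by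
    refine sum_congr rfl fun i _ => ?_
    rw [show (2 : ℝ) = (2 : ℕ) by norm_num, rpow_natCast, sq_abs]
  have hp4 : 0 ≤ ∑ i, hA.eigenvalues i ^ 4 := sum_nonneg fun i _ => by positivity
  have hp2 : 0 ≤ ∑ i, hA.eigenvalues i ^ 2 := sum_nonneg fun i _ => by positivity
  rw [h4, h2, div_pow, ← sqrt_eq_rpow, sq_sqrt hp2, ← rpow_mul_natCast hp4,
    show (1 : ℝ) / 4 * (2 : ℕ) = 1 / 2 by norm_num, ← sqrt_eq_rpow, sqrt_div (by positivity),
    sqrt_sq hp2, sqrt_mul (by norm_num)]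
  ring

end
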